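/- The inclusion of k-DB staged tree refinements in k-DB Bayesian network classifiers can be strict: there exists a k-DB refinement T (for some k \geq 1, e.g. with a binary class and binary features) such that \mathcal{M}_{T,\theta} is a proper subset of \mathcal{M}_{G_T}, i.e., there is a strictly positive distribution Markov to the k-DB BNC G_T that does not belong to the staged tree model \mathcal{M}_{T,\theta}. -/

import Mathlib

open Finset

section StagedTrees

variable {p : ℕ}

/-- A strictly positive probability distribution on the finite product space `∀ i, X i`. -/
def StrictlyPositiveDist {X : Fin p → Type*} [∀ i, Fintype (X i)]
    (P : (∀ i, X i) → ℝ) : Prop :=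
  (∀ x, 0 < P x) ∧ ∑ x, P x = 1

/-- The conditional probability `P(X i = a ∣ X_[i-1] = x_[i-1])`, where the prefix
`x_[i-1]` consists of the coordinates of `x` of index `< i`. -/
noncomputable def condProb {X : Fin p → Type*} [∀ i, Fintype (X i)] [∀ i, DecidableEq (X i)]
    (P : (∀ i, X i) → ℝ) (i : Fin p) (a : X i) (x : ∀ j, X j) : ℝ :=
  (∑ y ∈ univ.filter (fun y : ∀ j, X j => y i = a ∧ ∀ j, j < i → y j = x j), P y) /
    (∑ y ∈ univ.filter (fun y : ∀ j, X j => ∀ j, j < i → y j = x j), P y)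

/-- The conditional probability `P(X i = a ∣ X_A = x_A)` for a set `A` of coordinates. -/
noncomputable def condProbOn {X : Fin p → Type*} [∀ i, Fintype (X i)] [∀ i, DecidableEq (X i)]
    (P : (∀ i, X i) → ℝ) (A : Finset (Fin p)) (i : Fin p) (a : X i) (x : ∀ j, X j) : ℝ :=
  (∑ y ∈ univ.filter (fun y : ∀ j, X j => y i = a ∧ ∀ j ∈ A, y j = x j), P y) /
    (∑ y ∈ univ.filter (fun y : ∀ j, X j => ∀ j ∈ A, y j = x j), P y)

/-- A staging of the `X`-compatible staged tree: for each level `i`, a partition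
(equivalence relation) of the prefixes `x_[i-1]`, encoded as an equivalence relation on
full configurations that identifies configurations with the same prefix of length `i`
(coordinates of index `< i`). Vertices in the same class are in the same stage. -/
structure Staging (X : Fin p → Type*) where
  rel : Fin p → (∀ j, X j) → (∀ j, X j) → Prop
  equiv : ∀ i, Equivalence (rel i)
  prefix_mem : ∀ i x y, (∀ j, j < i → x j = y j) → rel i x y

/-- Membership in the staged tree model `𝓜_{T,θ}`: `P` is a strictly positive distribution and
prefixes in the same stage give equal conditional distributions for the next variable. -/
def MemStagedTreeModel {X : Fin p → Type*} [∀ i, Fintype (X i)] [∀ i, DecidableEq (X i)]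
    (σ : Staging X) (P : (∀ i, X i) → ℝ) : Prop :=
  StrictlyPositiveDist P ∧
    ∀ i x x', σ.rel i x x' → ∀ a : X i, condProb P i a x = condProb P i a x'

/-- A DAG on `{1,…,p}` compatible with the variable ordering, encoded by its parent sets:
every parent of `i` precedes `i`. -/
def OrderCompat (par : Fin p → Finset (Fin p)) : Prop :=
  ∀ i, ∀ j ∈ par i, j < i

/-- `P` is (strictly positive and) Markov to the DAG with parent sets `par`:
`P x = ∏ k P(x k ∣ x_{par k})`. -/
def MarkovTo {X : Fin p → Type*} [∀ i, Fintype (X i)] [∀ i, DecidableEq (X i)]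
    (par : Fin p → Finset (Fin p)) (P : (∀ i, X i) → ℝ) : Prop :=
  StrictlyPositiveDist P ∧ ∀ x, P x = ∏ i, condProbOn P (par i) i (x i) x

/-- `par` is the minimal DAG `G_T` of the staged tree with staging `σ`: it is order-compatible,
`𝓜_{T,θ} ⊆ 𝓜_{G_T}`, and its edge set is contained in the edge set of every order-compatible
DAG `G` with `𝓜_{T,θ} ⊆ 𝓜_G`. -/
def IsMinimalDAG {X : Fin p → Type*} [∀ i, Fintype (X i)] [∀ i, DecidableEq (X i)]
    (σ : Staging X) (par : Fin p → Finset (Fin p)) : Prop :=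
  OrderCompat par ∧ (∀ P, MemStagedTreeModel σ P → MarkovTo par P) ∧
    ∀ par', OrderCompat par' → (∀ P, MemStagedTreeModel σ P → MarkovTo par' P) →
      ∀ i, par i ⊆ par' i

/-- The number of stages at level `i` of a staging: the number of equivalence classes. -/
noncomputable def numStages {X : Fin p → Type*} (σ : Staging X) (i : Fin p) : ℕ :=
  Set.ncard {S : Set (∀ j, X j) | ∃ x, S = {y | σ.rel i x y}}

/-- In the classification setting the variables are `(C, X₁, …, X_q)` with the class `C` at
index `0`. A Bayesian network classifier: an order-compatible DAG in which `C` has no parents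
and `C` is a parent of every feature. -/
def IsBNC {q : ℕ} (par : Fin (q + 1) → Finset (Fin (q + 1))) : Prop :=
  OrderCompat par ∧ par 0 = ∅ ∧ ∀ i : Fin (q + 1), i ≠ 0 → (0 : Fin (q + 1)) ∈ par i

/-- A `k`-DB BNC: a BNC in which every feature has at most `k` feature parents. -/
def IsKDB {q : ℕ} (par : Fin (q + 1) → Finset (Fin (q + 1))) (k : ℕ) : Prop :=
  IsBNC par ∧ ∀ i, ((par i).erase 0).card ≤ k

end StagedTrees


lemma sum_cube (q : (Fin (2+1) → Bool) → Prop) [DecidablePred q] (P : (Fin (2+1) → Bool) → ℝ) :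
    ∑ y ∈ univ.filter q, P y =
      ∑ a : Bool, ∑ b : Bool, ∑ c : Bool, if q ![a, b, c] then P ![a, b, c] else 0 := by
  rw [Finset.sum_filter]
  rw [← Fintype.sum_prod_type' (f := fun a b => ∑ c : Bool, if q ![a, b, c] then P ![a, b, c] else 0),
    ← Fintype.sum_prod_type'
      (f := fun (t : Bool × Bool) c => if q ![t.1, t.2, c] then P ![t.1, t.2, c] else 0)]
  symm
  apply Fintype.sum_equiv
    (⟨fun t => ![t.1.1, t.1.2, t.2], fun y => ((y 0, y 1), y 2), fun t => rfl, fun y => by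
      ext j; fin_cases j <;> rfl⟩ : (Bool × Bool) × Bool ≃ (Fin (2+1) → Bool))
  intro t
  rfl

lemma sum_cube' (P : (Fin (2+1) → Bool) → ℝ) :
    ∑ y, P y = ∑ a : Bool, ∑ b : Bool, ∑ c : Bool, P ![a, b, c] := by
  have := sum_cube (fun _ => True) P
  simpa using this

lemma prod_cube (f : Fin (2+1) → ℝ) : ∏ i, f i = f 0 * f 1 * f 2 := Fin.prod_univ_three f

lemma condProb_cube (P : (Fin (2+1) → Bool) → ℝ) (i : Fin (2+1)) (a : Bool)
    (x : Fin (2+1) → Bool) :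
    condProb (X := fun _ : Fin (2+1) => Bool) P i a x =
      (∑ u : Bool, ∑ v : Bool, ∑ w : Bool,
        if (![u, v, w] : Fin (2+1) → Bool) i = a ∧ (0 < i → u = x 0) ∧ (1 < i → v = x 1) ∧
          (2 < i → w = x 2) then P ![u, v, w] else 0) /
      (∑ u : Bool, ∑ v : Bool, ∑ w : Bool,
        if (0 < i → u = x 0) ∧ (1 < i → v = x 1) ∧ (2 < i → w = x 2)
          then P ![u, v, w] else 0) := by
  unfold condProb
  have hall : ∀ (r : Fin (2+1) → Prop), (∀ j, r j) ↔ (r 0 ∧ r 1 ∧ r 2) := by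
    intro r
    simp [Fin.forall_fin_succ]
  refine congrArg₂ _ ((sum_cube _ _).trans ?_) ((sum_cube _ _).trans ?_)
  · refine Finset.sum_congr rfl fun u _ => Finset.sum_congr rfl fun v _ =>
      Finset.sum_congr rfl fun w _ => if_congr ?_ rfl rfl
    rw [hall]; rfl
  · refine Finset.sum_congr rfl fun u _ => Finset.sum_congr rfl fun v _ =>
      Finset.sum_congr rfl fun w _ => if_congr ?_ rfl rfl
    rw [hall]; rfl

lemma condProbOn_cube (P : (Fin (2+1) → Bool) → ℝ) (A : Finset (Fin (2+1))) (i : Fin (2+1))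
    (a : Bool) (x : Fin (2+1) → Bool) :
    condProbOn (X := fun _ : Fin (2+1) => Bool) P A i a x =
      (∑ u : Bool, ∑ v : Bool, ∑ w : Bool,
        if (![u, v, w] : Fin (2+1) → Bool) i = a ∧ (0 ∈ A → u = x 0) ∧ (1 ∈ A → v = x 1) ∧
          (2 ∈ A → w = x 2) then P ![u, v, w] else 0) /
      (∑ u : Bool, ∑ v : Bool, ∑ w : Bool,
        if (0 ∈ A → u = x 0) ∧ (1 ∈ A → v = x 1) ∧ (2 ∈ A → w = x 2)
          then P ![u, v, w] else 0) := by
  unfold condProbOn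
  have hall : ∀ (r : Fin (2+1) → Prop), (∀ j, r j) ↔ (r 0 ∧ r 1 ∧ r 2) := by
    intro r
    simp [Fin.forall_fin_succ]
  refine congrArg₂ _ ((sum_cube _ _).trans ?_) ((sum_cube _ _).trans ?_)
  · refine Finset.sum_congr rfl fun u _ => Finset.sum_congr rfl fun v _ =>
      Finset.sum_congr rfl fun w _ => if_congr ?_ rfl rfl
    rw [hall]; rfl
  · refine Finset.sum_congr rfl fun u _ => Finset.sum_congr rfl fun v _ =>
      Finset.sum_congr rfl fun w _ => if_congr ?_ rfl rfl
    rw [hall]; rfl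

lemma cube_eta (x : Fin (2+1) → Bool) : ∃ a b c, x = ![a, b, c] :=
  ⟨x 0, x 1, x 2, by ext j; fin_cases j <;> rfl⟩

/-- The staging: the prefixes of the last variable are staged by `C xor X₁`. -/
def xorStaging : Staging (fun _ : Fin (2 + 1) => Bool) where
  rel i x y := if i = 2 then xor (x 0) (x 1) = xor (y 0) (y 1) else ∀ j, j < i → x j = y j
  equiv i := by
    split_ifs
    · exact ⟨fun _ => rfl, fun h => h.symm, fun h h' => h.trans h'⟩
    · exact ⟨fun _ _ _ => rfl, fun h j hj => (h j hj).symm,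
        fun h h' j hj => (h j hj).trans (h' j hj)⟩
  prefix_mem i x y h := by
    split_ifs with hi
    · subst hi
      rw [h 0 (by decide), h 1 (by decide)]
    · exact h

/-- The complete order-compatible DAG. -/
def fullPar : Fin (2 + 1) → Finset (Fin (2 + 1)) := ![∅, {0}, {0, 1}]

lemma fullPar_markov (P : (Fin (2+1) → Bool) → ℝ)
    (hP : StrictlyPositiveDist (X := fun _ : Fin (2+1) => Bool) P) :
    MarkovTo (X := fun _ : Fin (2+1) => Bool) fullPar P := by
  refine ⟨hP, ?_⟩
  intro x
  have h1 := hP.2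
  rw [sum_cube'] at h1
  simp only [Fintype.sum_bool] at h1
  have hp : ∀ a b c, 0 < P ![a, b, c] := fun a b c => hP.1 _
  obtain ⟨a, b, c, rfl⟩ := cube_eta x
  rw [prod_cube]
  simp only [condProbOn_cube, fullPar, Fintype.sum_bool]
  have e1 := hp true true true
  have e2 := hp true true false
  have e3 := hp true false true
  have e4 := hp true false false
  have e5 := hp false true true
  have e6 := hp false true false
  have e7 := hp false false true
  have e8 := hp false false false
  cases a <;> cases b <;> cases c <;> simp [h1] <;> field_simp

/-- A member of the staged tree model with all dependencies present. -/
noncomputable def P0 (x : Fin (2+1) → Bool) : ℝ :=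
  1 / 18 * (if x 0 = x 1 then 1 else 2) * (if xor (x 0) (x 1) = x 2 then 1 else 2)

lemma P0_mem : MemStagedTreeModel xorStaging P0 := by
  refine ⟨⟨fun x => ?_, ?_⟩, ?_⟩
  · unfold P0; split_ifs <;> norm_num
  · rw [sum_cube']; simp [P0]; norm_num
  · intro i x x' h a
    by_cases hi : i = 2
    · subst hi
      have key : ∀ x : Fin (2+1) → Bool, condProb (X := fun _ : Fin (2+1) => Bool) P0 2 a x =
          if xor (x 0) (x 1) = a then 1/3 else 2/3 := by
        intro x
        obtain ⟨u, v, w, rfl⟩ := cube_eta x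
        simp only [condProb_cube, Fintype.sum_bool]
        cases u <;> cases v <;> cases a <;> simp [P0, Fin.lt_def] <;> norm_num
      have h' : xor (x 0) (x 1) = xor (x' 0) (x' 1) := by simpa [xorStaging] using h
      rw [key, key, h']
    · have h' : ∀ j, j < i → x j = x' j := by simpa [xorStaging, hi] using h
      unfold condProb
      congr 2
      · ext y; simp only [mem_filter, mem_univ, true_and]
        exact and_congr_right fun _ => forall₂_congr fun j hj => by rw [h' j hj]
      · ext y; simp only [mem_filter, mem_univ, true_and]
        exact forall₂_congr fun j hj => by rw [h' j hj]

lemma P0_min (par' : Fin (2 + 1) → Finset (Fin (2 + 1))) (ho : OrderCompat par')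
    (hm : MarkovTo (X := fun _ : Fin (2+1) => Bool) par' P0) : ∀ i, fullPar i ⊆ par' i := by
  have h := hm.2 ![false, false, false]
  have n00 : 0 ∉ par' 0 := fun h => absurd (ho _ _ h) (by decide)
  have n01 : 1 ∉ par' 0 := fun h => absurd (ho _ _ h) (by decide)
  have n02 : 2 ∉ par' 0 := fun h => absurd (ho _ _ h) (by decide)
  have n11 : 1 ∉ par' 1 := fun h => absurd (ho _ _ h) (by decide)
  have n12 : 2 ∉ par' 1 := fun h => absurd (ho _ _ h) (by decide)
  have n22 : 2 ∉ par' 2 := fun h => absurd (ho _ _ h) (by decide)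
  rw [prod_cube] at h
  simp only [condProbOn_cube, Fintype.sum_bool] at h
  have key : 0 ∈ par' 1 ∧ 0 ∈ par' 2 ∧ 1 ∈ par' 2 := by
    by_cases a : 0 ∈ par' 1 <;> by_cases b : 0 ∈ par' 2 <;> by_cases c : 1 ∈ par' 2 <;>
      simp [a, b, c, n00, n01, n02, n11, n12, n22, P0] at h ⊢ <;> norm_num at h
  obtain ⟨k1, k2, k3⟩ := key
  intro i
  fin_cases i
  · simp [fullPar]
  · simpa [fullPar] using k1
  · simpa [fullPar, Finset.insert_subset_iff] using ⟨k2, k3⟩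

/-- A positive distribution outside the staged tree model. -/
noncomputable def P1 (x : Fin (2+1) → Bool) : ℝ :=
  if x 0 = true ∧ x 1 = true ∧ x 2 = true then 2 / 9 else 1 / 9

/-- the inclusion `𝓜_{T,θ} ⊆ 𝓜_{G_T}` can be strict for `k`-DB refinements:
there is a `k`-DB refinement (some `k ≥ 1`, here with a binary class at index `0` and binary
features) and a strictly positive distribution Markov to the `k`-DB BNC `G_T` that does not
belong to the staged tree model `𝓜_{T,θ}`. -/
theorem kdb_refinement_strictly_refines :
    ∃ (k : ℕ) (σ : Staging (fun _ : Fin (2 + 1) => Bool))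
      (par : Fin (2 + 1) → Finset (Fin (2 + 1))),
      1 ≤ k ∧ IsMinimalDAG σ par ∧ IsKDB par k ∧
      ∃ P : (∀ _ : Fin (2 + 1), Bool) → ℝ,
        MarkovTo par P ∧ ¬ MemStagedTreeModel σ P := by
  have hc : OrderCompat fullPar := by unfold OrderCompat fullPar; decide
  refine ⟨1, xorStaging, fullPar, le_rfl,
    ⟨hc, fun P hP => fullPar_markov P hP.1, fun par' ho hm => P0_min par' ho (hm P0 P0_mem)⟩,
    ⟨⟨hc, rfl, by unfold fullPar; decide⟩, by unfold fullPar; decide⟩,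
    P1, fullPar_markov P1 ⟨fun x => ?_, ?_⟩, ?_⟩
  · unfold P1; split_ifs <;> norm_num
  · rw [sum_cube']; simp [P1]; norm_num
  · intro h
    have := h.2 2 ![true, true, true] ![false, false, false] (by simp [xorStaging]) true
    simp only [condProb_cube, Fintype.sum_bool] at this
    simp [P1, Fin.lt_def] at this
    norm_num at this
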